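/- Nonlocal Brezis–Lieb lemma for the Hardy–Littlewood–Sobolev energy: Let n ≥ 3, 0 < μ < n, 2_μ^* = (2n − μ)/(n − 2) and 2^* = 2n/(n − 2). Let (u_k) be a sequence of measurable functions on ℝ^n with sup_k ‖u_k‖_{L^{2^*}} < ∞ and u_k → u almost everywhere on ℝ^n. Writing B(v) = ∫_{ℝ^n} ∫_{ℝ^n} |v(x)|^{2_μ^*} |v(y)|^{2_μ^*} / ‖x − y‖^μ dx dy, one has lim_{k → ∞} ( B(u_k) − B(u_k − u) ) = B(u). -/

import Mathlib

open MeasureTheory ENNReal Filter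

/-- The Hardy–Littlewood–Sobolev (Choquard) energy
`B(v) = ∫∫ |v(x)|^{2_μ^*} |v(y)|^{2_μ^*} / ‖x - y‖^μ dx dy`. -/
noncomputable def hlsEnergy (n : ℕ) (μ : ℝ) (v : EuclideanSpace ℝ (Fin n) → ℝ) : ℝ≥0∞ :=
  ∫⁻ x, ∫⁻ y, ENNReal.ofReal
    (|v x| ^ ((2 * (n : ℝ) - μ) / ((n : ℝ) - 2)) *
      |v y| ^ ((2 * (n : ℝ) - μ) / ((n : ℝ) - 2)) / ‖x - y‖ ^ μ)



lemma bl_scale (n : ℕ) (f : EuclideanSpace ℝ (Fin n) → ℝ≥0∞) (hf : Measurable f) (R : ℝ) (hR : 0 < R) :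
    ∫⁻ z, f z = ENNReal.ofReal (R ^ (n:ℝ)) * ∫⁻ z, f (R • z) := by
  have h := Measure.map_addHaar_smul (volume : Measure (EuclideanSpace ℝ (Fin n))) hR.ne'
  have h2 : ∫⁻ z, f (R • z) = ∫⁻ z, f z ∂(Measure.map (R • ·) volume) := by
    rw [lintegral_map hf (measurable_const_smul R)]
  rw [h2, h, lintegral_smul_measure, smul_eq_mul, ← mul_assoc, ← ENNReal.ofReal_mul (by positivity)]
  simp only [finrank_euclideanSpace, Fintype.card_fin]
  rw [abs_of_pos (by positivity), Real.rpow_natCast, mul_inv_cancel₀ (by positivity)]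
  simp

lemma bl_scale_ind (n : ℕ) (s : ℝ) (A : Set ℝ) (hA : MeasurableSet A) (R : ℝ) (hR : 0 < R) :
    ∫⁻ z : EuclideanSpace ℝ (Fin n), (A.indicator (fun t => ENNReal.ofReal (t ^ (-s))) (‖z‖ / R)) 
     * ENNReal.ofReal (R ^ (-s)) = 
     ENNReal.ofReal (R ^ ((n:ℝ) - s)) * 
      ∫⁻ z : EuclideanSpace ℝ (Fin n), A.indicator (fun t => ENNReal.ofReal (t ^ (-s))) ‖z‖ := by
  have hm : Measurable (A.indicator (fun t : ℝ => ENNReal.ofReal (t ^ (-s)))) :=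
    Measurable.indicator (by fun_prop) hA
  rw [bl_scale n _ (by fun_prop) R hR]
  simp only [norm_smul, Real.norm_eq_abs, abs_of_pos hR, mul_div_cancel_left₀ _ hR.ne']
  rw [lintegral_mul_const _ (by fun_prop), sub_eq_add_neg, Real.rpow_add hR, ENNReal.ofReal_mul (by positivity)]
  ring

lemma bl_near (n : ℕ) (hn : 1 ≤ n) (s : ℝ) (hs : s < n) :
    ∃ c : ℝ≥0∞, c ≠ ⊤ ∧ ∀ R : ℝ, 0 < R → ∫⁻ z : EuclideanSpace ℝ (Fin n), 
      (if ‖z‖ < R then ENNReal.ofReal (‖z‖ ^ (-s)) else 0) = ENNReal.ofReal (R ^ ((n:ℝ) - s)) * c := by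
  refine ⟨∫⁻ z : EuclideanSpace ℝ (Fin n), (Set.Iio 1).indicator (fun t => ENNReal.ofReal (t ^ (-s))) ‖z‖, ?_, ?_⟩
  · have : Nontrivial (EuclideanSpace ℝ (Fin n)) := by
      have : Nonempty (Fin n) := ⟨⟨0, by omega⟩⟩
      infer_instance
    have h : IntegrableOn (fun z : EuclideanSpace ℝ (Fin n) => ‖z‖ ^ (-s)) (Metric.ball 0 1) volume := by
      rw [integrableOn_fun_norm_addHaar volume (f := fun t => t ^ (-s))]
      have h1 : IntegrableOn (fun y : ℝ => y ^ ((n:ℝ) - 1 - s)) (Set.Ioo 0 1) := by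
        rw [intervalIntegral.integrableOn_Ioo_rpow_iff (by norm_num)]
        linarith
      refine h1.congr_fun ?_ measurableSet_Ioo
      intro y hy
      simp only [finrank_euclideanSpace, Fintype.card_fin, smul_eq_mul]
      rw [← Real.rpow_natCast, ← Real.rpow_add hy.1]
      congr 1
      push_cast [hn]
      ring
    have h2 := (integrable_indicator_iff Metric.isOpen_ball.measurableSet).mpr h
    have h3 := h2.lintegral_lt_top
    refine ne_of_lt (lt_of_eq_of_lt (lintegral_congr fun z => ?_) h3)
    by_cases hz : ‖z‖ < 1 <;> simp [hz]
  · intro R hR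
    rw [← bl_scale_ind n s _ measurableSet_Iio R hR]
    refine lintegral_congr fun z => ?_
    by_cases hz : ‖z‖ < R
    · rw [if_pos hz, Set.indicator_of_mem (by simpa [div_lt_one hR] using hz), ← ENNReal.ofReal_mul (by positivity),
       ← Real.mul_rpow (by positivity) hR.le, div_mul_cancel₀ _ hR.ne']
    · rw [if_neg hz, Set.indicator_of_notMem (by simpa [div_lt_one hR] using hz), zero_mul]

lemma bl_far (n : ℕ) (s : ℝ) (hs : n < s) :
    ∃ c : ℝ≥0∞, c ≠ ⊤ ∧ ∀ R : ℝ, 0 < R → ∫⁻ z : EuclideanSpace ℝ (Fin n), 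
      (if ‖z‖ < R then 0 else ENNReal.ofReal (‖z‖ ^ (-s))) = ENNReal.ofReal (R ^ ((n:ℝ) - s)) * c := by
  refine ⟨∫⁻ z : EuclideanSpace ℝ (Fin n), (Set.Ici 1).indicator (fun t => ENNReal.ofReal (t ^ (-s))) ‖z‖, ?_, ?_⟩
  · have h := finite_integral_one_add_norm (E := EuclideanSpace ℝ (Fin n)) (μ := volume) (r := s) (by simpa using hs)
    have h2 : ∫⁻ z : EuclideanSpace ℝ (Fin n), ENNReal.ofReal (2 ^ s) * ENNReal.ofReal ((1 + ‖z‖) ^ (-s)) < ⊤ := by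
      rw [lintegral_const_mul _ (by fun_prop)]
      exact ENNReal.mul_lt_top ENNReal.ofReal_lt_top h
    refine ne_of_lt (lt_of_le_of_lt (lintegral_mono fun z => ?_) h2)
    by_cases hz : 1 ≤ ‖z‖
    · simp only [Set.indicator_of_mem (show ‖z‖ ∈ Set.Ici 1 from hz)]
      rw [← ENNReal.ofReal_mul (by positivity)]
      apply ENNReal.ofReal_le_ofReal
      have e : (2:ℝ) ^ s = (1/2) ^ (-s) := by
        rw [one_div, Real.inv_rpow (by norm_num), Real.rpow_neg (by norm_num), inv_inv]
      rw [e, ← Real.mul_rpow (by positivity) (by positivity)]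
      apply Real.rpow_le_rpow_of_nonpos (by positivity) (by linarith)
      have : (0:ℝ) ≤ n := by positivity
      linarith
    · simp [hz]
  · intro R hR
    rw [← bl_scale_ind n s _ measurableSet_Ici R hR]
    refine lintegral_congr fun z => ?_
    by_cases hz : ‖z‖ < R
    · rw [if_pos hz, Set.indicator_of_notMem (by simpa [one_le_div hR] using hz), zero_mul]
    · rw [if_neg hz, Set.indicator_of_mem (by simpa [one_le_div hR] using hz), ← ENNReal.ofReal_mul (by positivity),
       ← Real.mul_rpow (by positivity) hR.le, div_mul_cancel₀ _ hR.ne']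

noncomputable def blK (n : ℕ) (μ : ℝ) (z : EuclideanSpace ℝ (Fin n)) : ℝ≥0∞ :=
  ENNReal.ofReal (‖z‖ ^ (-μ))

lemma blK_meas (n : ℕ) (μ : ℝ) : Measurable (blK n μ) := by
  unfold blK; fun_prop

lemma bl_inner (n : ℕ) (hn : 1 ≤ n) (μ : ℝ) (hμ0 : 0 < μ) (hμn : μ < n) (r : ℝ)
    (hr : r = 2 * n / (2 * n - μ)) :
    ∃ C : ℝ≥0∞, C ≠ ⊤ ∧ 1 ≤ C ∧ ∀ G : EuclideanSpace ℝ (Fin n) → ℝ≥0∞, Measurable G →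
      ∫⁻ y, G y ^ r ≤ 1 → ∀ (x : EuclideanSpace ℝ (Fin n)) (t : ℝ≥0∞),
        ∫⁻ y, t * min t (G y) * blK n μ (x - y) ≤ C * t ^ r := by
  have hn0 : (0:ℝ) < n := by exact_mod_cast hn
  have hd : 0 < 2 * (n:ℝ) - μ := by linarith
  have hr0 : 0 < r := by rw [hr]; positivity
  obtain ⟨c1, hc1, h1⟩ := bl_near n hn μ hμn
  obtain ⟨c2, hc2, h2⟩ := bl_far n (2 * n) (by linarith)
  set q : ℝ := 2 * n / μ with hq
  have hq0 : 0 < q := by positivity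
  have hconj : r.HolderConjugate q := by
    rw [Real.holderConjugate_iff]
    constructor
    · rw [hr, lt_div_iff₀ hd]; linarith
    · rw [hr, hq]; field_simp; ring
  refine ⟨c1 + c2 ^ (1 / q) + 1, ?_, by simp, ?_⟩
  · simp [ENNReal.add_eq_top, hc1, ENNReal.rpow_eq_top_iff, hc2, hq0, hq0.le]
  intro G hG hG1 x t
  rcases eq_or_ne t 0 with rfl | ht0
  · simp
  rcases eq_or_ne t ⊤ with rfl | htt
  · rw [ENNReal.top_rpow_of_pos hr0, ENNReal.mul_top (by simp)]; exact le_top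
  obtain ⟨τ, hτ, rfl⟩ : ∃ τ : ℝ, 0 < τ ∧ t = ENNReal.ofReal τ :=
    ⟨t.toReal, ENNReal.toReal_pos ht0 htt, (ENNReal.ofReal_toReal htt).symm⟩
  set R : ℝ := τ ^ (-r / n) with hR
  have hR0 : 0 < R := by positivity
  set N : EuclideanSpace ℝ (Fin n) → ℝ≥0∞ := fun z => if ‖z‖ < R then ENNReal.ofReal (‖z‖ ^ (-μ)) else 0 with hN
  set F : EuclideanSpace ℝ (Fin n) → ℝ≥0∞ := fun z => if ‖z‖ < R then 0 else ENNReal.ofReal (‖z‖ ^ (-μ)) with hF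
  have hNm : Measurable N := Measurable.ite (measurableSet_lt measurable_norm measurable_const) (by fun_prop) (by fun_prop)
  have hFm : Measurable F := Measurable.ite (measurableSet_lt measurable_norm measurable_const) (by fun_prop) (by fun_prop)
  set t := ENNReal.ofReal τ with ht
  have hNF : ∫⁻ y, N (x - y) = ENNReal.ofReal (R ^ ((n:ℝ) - μ)) * c1 := by
    rw [lintegral_sub_left_eq_self (fun y => N y) x, h1 R hR0]
  have hFF : ∫⁻ y, F (x - y) ^ q = ENNReal.ofReal (R ^ (-(n:ℝ))) * c2 := by
    rw [lintegral_sub_left_eq_self (fun y => F y ^ q) x]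
    have := h2 R hR0
    rw [show (n:ℝ) - 2 * n = -n by ring] at this
    rw [← this]
    refine lintegral_congr fun z => ?_
    simp only [hF]
    split_ifs with h
    · exact ENNReal.zero_rpow_of_pos hq0
    · rw [ENNReal.ofReal_rpow_of_nonneg (by positivity) hq0.le, ← Real.rpow_mul (by positivity)]
      congr 2
      rw [hq]; field_simp
  have hol : ∫⁻ y, G y * F (x - y) ≤ ENNReal.ofReal (R ^ (-(μ/2))) * c2 ^ (1/q) := by
    have h := ENNReal.lintegral_mul_le_Lp_mul_Lq volume hconj hG.aemeasurable
      (g := fun y => F (x - y)) (hFm.comp (measurable_const.sub measurable_id)).aemeasurable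
    refine h.trans ?_
    rw [hFF, ENNReal.mul_rpow_of_nonneg _ _ (by positivity), ENNReal.ofReal_rpow_of_nonneg (by positivity) (by positivity),
      ← Real.rpow_mul hR0.le]
    have e : -(n:ℝ) * (1 / q) = -(μ/2) := by rw [hq]; field_simp
    rw [e]
    calc _ ≤ 1 * (ENNReal.ofReal (R ^ (-(μ / 2))) * c2 ^ (1 / q)) := by
            gcongr
            exact ENNReal.rpow_le_one hG1 (by positivity)
      _ = _ := one_mul _
  have hpt : ∀ y, t * min t (G y) * blK n μ (x - y) ≤ t * t * N (x - y) + t * (G y * F (x - y)) := by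
    intro y
    simp only [hN, hF, blK]
    split_ifs with h
    · rw [mul_zero, mul_zero, add_zero]; gcongr; exact min_le_left _ _
    · rw [mul_zero, zero_add, mul_assoc]; gcongr; exact min_le_right _ _
  have hNm' : Measurable (fun y => N (x - y)) := hNm.comp (measurable_const.sub measurable_id)
  have hFm' : Measurable (fun y => F (x - y)) := hFm.comp (measurable_const.sub measurable_id)
  have e1 : t * t * ENNReal.ofReal (R ^ ((n:ℝ) - μ)) = t ^ r := by
    rw [ht, ← ENNReal.ofReal_mul hτ.le, ← ENNReal.ofReal_mul (by positivity), ENNReal.ofReal_rpow_of_pos hτ, hR,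
     ← Real.rpow_mul hτ.le]
    congr 1
    have : τ * τ = τ ^ (2:ℝ) := by rw [Real.rpow_two]; ring
    rw [this, ← Real.rpow_add hτ]
    congr 1
    rw [hr]; field_simp; ring
  have e2 : t * ENNReal.ofReal (R ^ (-(μ/2))) = t ^ r := by
    rw [ht, ← ENNReal.ofReal_mul hτ.le, ENNReal.ofReal_rpow_of_pos hτ, hR,
     ← Real.rpow_mul hτ.le]
    congr 1
    nth_rw 1 [← Real.rpow_one τ]
    rw [← Real.rpow_add hτ]
    congr 1
    rw [hr]; field_simp; ring
  calc _ ≤ ∫⁻ y, (t * t * N (x - y) + t * (G y * F (x - y))) := lintegral_mono hpt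
    _ = t * t * (∫⁻ y, N (x - y)) + t * (∫⁻ y, G y * F (x - y)) := by
        rw [lintegral_add_left (by fun_prop), lintegral_const_mul _ hNm', lintegral_const_mul _ (by fun_prop)]
    _ ≤ t * t * (ENNReal.ofReal (R ^ ((n:ℝ) - μ)) * c1) + t * (ENNReal.ofReal (R ^ (-(μ/2))) * c2 ^ (1/q)) := by
        rw [hNF]; gcongr
    _ = c1 * t ^ r + c2 ^ (1/q) * t ^ r := by
        rw [← mul_assoc, e1, ← mul_assoc, e2]; ring
    _ ≤ _ := by
        rw [← add_mul]; exact mul_le_mul' le_self_add le_rfl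

noncomputable def blD (n : ℕ) (μ : ℝ) (F G : EuclideanSpace ℝ (Fin n) → ℝ≥0∞) : ℝ≥0∞ :=
  ∫⁻ x, ∫⁻ y, F x * G y * blK n μ (x - y)

lemma blK_symm (n : ℕ) (μ : ℝ) (x y : EuclideanSpace ℝ (Fin n)) : blK n μ (x - y) = blK n μ (y - x) := by
  unfold blK; rw [norm_sub_rev]

lemma blD_symm (n : ℕ) (μ : ℝ) (F G : EuclideanSpace ℝ (Fin n) → ℝ≥0∞) (hF : Measurable F) (hG : Measurable G) :
    blD n μ F G = blD n μ G F := by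
  unfold blD
  have hK := blK_meas n μ
  rw [lintegral_lintegral_swap (by unfold Function.uncurry; fun_prop)]
  refine lintegral_congr fun x => lintegral_congr fun y => ?_
  rw [blK_symm, mul_comm (F y)]

lemma blD_add_left (n : ℕ) (μ : ℝ) (F F' G : EuclideanSpace ℝ (Fin n) → ℝ≥0∞) (hF : Measurable F) (hG : Measurable G) :
    blD n μ (fun x => F x + F' x) G = blD n μ F G + blD n μ F' G := by
  unfold blD
  have hK := blK_meas n μ
  rw [← lintegral_add_left (Measurable.lintegral_prod_right' (f := fun z : EuclideanSpace ℝ (Fin n) × EuclideanSpace ℝ (Fin n) => F z.1 * G z.2 * blK n μ (z.1 - z.2)) (by fun_prop))]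
  refine lintegral_congr fun x => ?_
  rw [← lintegral_add_left (by fun_prop)]
  refine lintegral_congr fun y => ?_
  ring

lemma blD_mono (n : ℕ) (μ : ℝ) (F F' G G' : EuclideanSpace ℝ (Fin n) → ℝ≥0∞) (h : ∀ x, F x ≤ F' x) (h' : ∀ x, G x ≤ G' x) :
    blD n μ F G ≤ blD n μ F' G' := by
  unfold blD
  refine lintegral_mono fun x => lintegral_mono fun y => ?_
  exact mul_le_mul' (mul_le_mul' (h x) (h' y)) le_rfl

lemma blD_smul (n : ℕ) (μ : ℝ) (F G : EuclideanSpace ℝ (Fin n) → ℝ≥0∞) (hF : Measurable F) (hG : Measurable G) (a b : ℝ≥0∞) :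
    blD n μ (fun x => a * F x) (fun x => b * G x) = a * b * blD n μ F G := by
  unfold blD
  have hK := blK_meas n μ
  rw [← lintegral_const_mul _ (Measurable.lintegral_prod_right' (f := fun z : EuclideanSpace ℝ (Fin n) × EuclideanSpace ℝ (Fin n) => F z.1 * G z.2 * blK n μ (z.1 - z.2)) (by fun_prop))]
  refine lintegral_congr fun x => ?_
  rw [← lintegral_const_mul _ (by fun_prop)]
  refine lintegral_congr fun y => ?_
  ring

lemma bl_hls_one (n : ℕ) (hn : 1 ≤ n) (μ : ℝ) (hμ0 : 0 < μ) (hμn : μ < n) (r : ℝ)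
    (hr : r = 2 * n / (2 * n - μ)) :
    ∃ C : ℝ≥0∞, C ≠ ⊤ ∧ ∀ F G : EuclideanSpace ℝ (Fin n) → ℝ≥0∞, Measurable F → Measurable G →
      ∫⁻ y, F y ^ r ≤ 1 → ∫⁻ y, G y ^ r ≤ 1 → blD n μ F G ≤ C := by
  obtain ⟨C, hC, -, h⟩ := bl_inner n hn μ hμ0 hμn r hr
  have hK := blK_meas n μ
  have half : ∀ F G : EuclideanSpace ℝ (Fin n) → ℝ≥0∞, Measurable F → Measurable G →
      ∫⁻ y, F y ^ r ≤ 1 → ∫⁻ y, G y ^ r ≤ 1 → ∫⁻ x, ∫⁻ y, F x * min (F x) (G y) * blK n μ (x - y) ≤ C := by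
    intro F G hF hG hF1 hG1
    calc _ ≤ ∫⁻ x, C * F x ^ r := lintegral_mono fun x => h G hG hG1 x (F x)
      _ = C * ∫⁻ x, F x ^ r := lintegral_const_mul _ (by fun_prop)
      _ ≤ C * 1 := by gcongr
      _ = C := mul_one C
  refine ⟨C + C, by simp [hC], fun F G hF hG hF1 hG1 => ?_⟩
  have h2 : blD n μ F G ≤ ∫⁻ x, ∫⁻ y, (F x * min (F x) (G y) * blK n μ (x - y) + G y * min (G y) (F x) * blK n μ (y - x)) := by
    refine lintegral_mono fun x => lintegral_mono fun y => ?_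
    simp only
    rw [blK_symm n μ y x, ← add_mul]
    gcongr
    rcases le_total (F x) (G y) with h | h
    · rw [min_eq_right h, mul_comm]; exact le_add_self
    · rw [min_eq_right h]; exact le_self_add
  refine h2.trans ?_
  have e : ∀ x, ∫⁻ y, (F x * min (F x) (G y) * blK n μ (x - y) + G y * min (G y) (F x) * blK n μ (y - x))
     = (∫⁻ y, F x * min (F x) (G y) * blK n μ (x - y)) + ∫⁻ y, G y * min (G y) (F x) * blK n μ (y - x) :=
    fun x => lintegral_add_left (by fun_prop) _
  simp_rw [e]
  rw [lintegral_add_left (Measurable.lintegral_prod_right' (f := fun z : EuclideanSpace ℝ (Fin n) × EuclideanSpace ℝ (Fin n) => F z.1 * min (F z.1) (G z.2) * blK n μ (z.1 - z.2)) (by fun_prop))]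
  refine add_le_add (half F G hF hG hF1 hG1) ?_
  rw [lintegral_lintegral_swap (by unfold Function.uncurry; fun_prop)]
  exact half G F hG hF hG1 hF1

lemma bl_hls (n : ℕ) (hn : 1 ≤ n) (μ : ℝ) (hμ0 : 0 < μ) (hμn : μ < n) (r : ℝ)
    (hr : r = 2 * n / (2 * n - μ)) :
    ∃ C : ℝ≥0∞, C ≠ ⊤ ∧ ∀ F G : EuclideanSpace ℝ (Fin n) → ℝ≥0∞, Measurable F → Measurable G →
      ∀ A B : ℝ≥0∞, A ≠ 0 → A ≠ ⊤ → B ≠ 0 → B ≠ ⊤ → 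
      ∫⁻ y, F y ^ r ≤ A ^ r → ∫⁻ y, G y ^ r ≤ B ^ r → blD n μ F G ≤ C * A * B := by
  obtain ⟨C, hC, h⟩ := bl_hls_one n hn μ hμ0 hμn r hr
  have hn0 : (0:ℝ) < n := by exact_mod_cast hn
  have hd : 0 < 2 * (n:ℝ) - μ := by linarith
  have hr0 : 0 < r := by rw [hr]; positivity
  refine ⟨C, hC, fun F G hF hG A B hA hA' hB hB' hFA hGB => ?_⟩
  have aux : ∀ F : EuclideanSpace ℝ (Fin n) → ℝ≥0∞, Measurable F → ∀ A : ℝ≥0∞, A ≠ 0 → A ≠ ⊤ → 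
      ∫⁻ y, F y ^ r ≤ A ^ r → ∫⁻ y, (A⁻¹ * F y) ^ r ≤ 1 := by
    intro F hF A hA hA' hFA
    simp_rw [ENNReal.mul_rpow_of_nonneg _ _ hr0.le]
    rw [lintegral_const_mul _ (by fun_prop)]
    calc _ ≤ A⁻¹ ^ r * A ^ r := by gcongr
      _ = 1 := by rw [← ENNReal.mul_rpow_of_nonneg _ _ hr0.le, ENNReal.inv_mul_cancel hA hA', ENNReal.one_rpow]
  have := h (fun x => A⁻¹ * F x) (fun x => B⁻¹ * G x) (by fun_prop) (by fun_prop) (aux F hF A hA hA' hFA) (aux G hG B hB hB' hGB)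
  rw [blD_smul n μ F G hF hG] at this
  calc blD n μ F G = (A * A⁻¹) * (B * B⁻¹) * blD n μ F G := by
        rw [ENNReal.mul_inv_cancel hA hA', ENNReal.mul_inv_cancel hB hB']; simp
    _ = A * B * (A⁻¹ * B⁻¹ * blD n μ F G) := by ring
    _ ≤ A * B * C := by gcongr
    _ = _ := by ring

lemma bl_dct {α : Type*} [MeasurableSpace α] (ν : Measure α) (F w : ℕ → α → ℝ≥0∞)
    (hF : ∀ k, Measurable (F k)) (hw : ∀ k, Measurable (w k))
    (h0 : ∀ᵐ x ∂ν, Tendsto (fun k => F k x) atTop (nhds 0))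
    (M : ℝ≥0∞) (hM : M ≠ ⊤) (hwM : ∀ k, ∫⁻ x, w k x ∂ν ≤ M)
    (hb : ∀ ε : ℝ≥0∞, ε ≠ 0 → ε ≠ ⊤ → ∃ H : α → ℝ≥0∞, ∫⁻ x, H x ∂ν ≠ ⊤ ∧ ∀ k x, F k x ≤ ε * w k x + H x) :
    Tendsto (fun k => ∫⁻ x, F k x ∂ν) atTop (nhds 0) := by
  rw [ENNReal.tendsto_nhds_zero]
  intro η hη
  rcases eq_or_ne η ⊤ with rfl | hηt
  · simp
  have hη2 : η / 2 ≠ 0 := (ENNReal.half_pos hη.ne').ne'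
  have hη2t : η / 2 ≠ ⊤ := (ENNReal.div_lt_top hηt (by norm_num)).ne
  have hM1 : M + 1 ≠ ⊤ := by simp [hM]
  obtain ⟨H, hH, hle⟩ := hb (η / 2 / (M + 1)) (ENNReal.div_ne_zero.mpr ⟨hη2, hM1⟩)
    (ENNReal.div_lt_top hη2t (by simp)).ne
  set ε := η / 2 / (M + 1) with hε
  have hT : Tendsto (fun k => ∫⁻ x, (F k x - ε * w k x) ∂ν) atTop (nhds (∫⁻ x, 0 ∂ν)) := by
    refine tendsto_lintegral_of_dominated_convergence H (fun k => (hF k).sub ((hw k).const_mul _)) ?_ hH ?_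
    · intro k
      exact Eventually.of_forall fun x => tsub_le_iff_left.mpr (hle k x)
    · filter_upwards [h0] with x hx
      exact tendsto_of_tendsto_of_tendsto_of_le_of_le tendsto_const_nhds hx (fun _ => zero_le) (fun _ => tsub_le_self)
  rw [lintegral_zero, ENNReal.tendsto_nhds_zero] at hT
  filter_upwards [hT (η / 2) (pos_iff_ne_zero.mpr hη2)] with k hk
  calc ∫⁻ x, F k x ∂ν ≤ ∫⁻ x, (ε * w k x + (F k x - ε * w k x)) ∂ν := lintegral_mono fun x => le_add_tsub
    _ = ε * (∫⁻ x, w k x ∂ν) + ∫⁻ x, (F k x - ε * w k x) ∂ν := by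
        rw [lintegral_add_left ((hw k).const_mul _), lintegral_const_mul _ (hw k)]
    _ ≤ η / 2 + η / 2 := by
        refine add_le_add ?_ hk
        calc _ ≤ ε * (M + 1) := by gcongr; exact (hwM k).trans le_self_add
          _ = η / 2 := ENNReal.div_mul_cancel (by simp) hM1
    _ = η := ENNReal.add_halves η

lemma bl_dual (n : ℕ) (r q : ℝ) (hrq : r.HolderConjugate q) (φ : EuclideanSpace ℝ (Fin n) → ℝ≥0∞) (hφ : Measurable φ)
    (C : ℝ≥0∞) (hC : C ≠ ⊤)
    (h : ∀ G : EuclideanSpace ℝ (Fin n) → ℝ≥0∞, Measurable G → ∫⁻ x, G x ^ r ≤ 1 → ∫⁻ x, G x * φ x ≤ C) :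
    ∫⁻ x, φ x ^ q ≠ ⊤ := by
  have hq0 : 0 < q := hrq.symm.pos
  have hr0 : 0 < r := hrq.pos
  have hq1 : 0 < q - 1 := by linarith [hrq.symm.lt]
  set ψ : ℕ → EuclideanSpace ℝ (Fin n) → ℝ≥0∞ := fun N => 
    (Metric.ball 0 N).indicator (fun x => min (φ x) N) with hψ
  have hψm : ∀ N, Measurable (ψ N) := fun N => 
    Measurable.indicator (by fun_prop) Metric.isOpen_ball.measurableSet
  have hψφ : ∀ N x, ψ N x ≤ φ x := by
    intro N x
    exact Set.indicator_le (s := Metric.ball 0 (N:ℝ)) (f := fun x => min (φ x) N) (g := φ) (fun _ _ => min_le_left _ _) x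
  have hI : ∀ N, ∫⁻ x, ψ N x ^ q ≠ ⊤ := by
    intro N
    have : ∫⁻ x, (Metric.ball (0:EuclideanSpace ℝ (Fin n)) N).indicator (fun _ => (N:ℝ≥0∞) ^ q) x ≠ ⊤ := by
      rw [lintegral_indicator_const Metric.isOpen_ball.measurableSet]
      exact ENNReal.mul_ne_top (ENNReal.rpow_ne_top_of_nonneg hq0.le (by simp)) measure_ball_lt_top.ne
    refine ne_top_of_le_ne_top this (lintegral_mono fun x => ?_)
    simp only [hψ]
    by_cases hx : x ∈ Metric.ball (0:EuclideanSpace ℝ (Fin n)) (N:ℝ)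
    · simp only [Set.indicator_of_mem hx]; gcongr; exact min_le_right _ _
    · simp only [Set.indicator_of_notMem hx]; rw [ENNReal.zero_rpow_of_pos hq0]
  have hbound : ∀ N, ∫⁻ x, ψ N x ^ q ≤ C ^ q := by
    intro N
    set I := ∫⁻ x, ψ N x ^ q with hIdef
    rcases eq_or_ne I 0 with h0 | h0
    · rw [h0]; exact zero_le
    have hIt : I ≠ ⊤ := hI N
    have := h (fun x => I ^ (-(1/r)) * ψ N x ^ (q - 1)) (by fun_prop) (by
      simp_rw [ENNReal.mul_rpow_of_nonneg _ _ hr0.le, ← ENNReal.rpow_mul]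
      have e1 : (q - 1) * r = q := by
        have := hrq.symm.mul_eq_add
        linarith
      have e2 : -(1/r) * r = -1 := by field_simp
      rw [e1, e2, lintegral_const_mul _ (by fun_prop), ← hIdef, ENNReal.rpow_neg_one, ENNReal.inv_mul_cancel h0 hIt])
    have h3 : I ^ (1/q) ≤ C := by
      refine le_trans ?_ this
      calc I ^ (1/q) = I ^ (-(1/r)) * I := by
            conv_rhs => rw [← ENNReal.rpow_one I, ← ENNReal.rpow_mul, ← ENNReal.rpow_add _ _ h0 hIt]
            congr 1
            have := hrq.inv_add_inv_eq_one
            simp only [one_div]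
            linarith
        _ = ∫⁻ x, I ^ (-(1/r)) * ψ N x ^ q := by
            rw [lintegral_const_mul _ (by fun_prop)]
        _ ≤ _ := by
            refine lintegral_mono fun x => ?_
            simp only
            rw [mul_assoc]
            gcongr
            calc ψ N x ^ q = ψ N x ^ (q - 1) * ψ N x ^ (1:ℝ) := by
                  rw [← ENNReal.rpow_add_of_nonneg _ _ hq1.le zero_le_one]; congr 1; ring
              _ ≤ _ := by rw [ENNReal.rpow_one]; gcongr; exact hψφ N x
    calc I = (I ^ (1/q)) ^ q := by rw [← ENNReal.rpow_mul, one_div_mul_cancel hq0.ne', ENNReal.rpow_one]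
      _ ≤ C ^ q := by gcongr
  have hlim : ∀ x, Tendsto (fun N => ψ N x ^ q) atTop (nhds (φ x ^ q)) := by
    intro x
    refine (ENNReal.continuous_rpow_const.tendsto _).comp ?_
    have h1 : Tendsto (fun N : ℕ => min (φ x) (N:ℝ≥0∞)) atTop (nhds (min (φ x) ⊤)) :=
      tendsto_const_nhds.min ENNReal.tendsto_nat_nhds_top
    rw [min_top_right] at h1
    refine h1.congr' ?_
    obtain ⟨N0, hN0⟩ := exists_nat_gt ‖x‖
    filter_upwards [eventually_ge_atTop N0] with N hN
    simp only [hψ]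
    rw [Set.indicator_of_mem]
    rw [mem_ball_zero_iff]
    exact hN0.trans_le (by exact_mod_cast hN)
  have hfatou : ∫⁻ x, φ x ^ q ≤ C ^ q := by
    calc ∫⁻ x, φ x ^ q = ∫⁻ x, liminf (fun N => ψ N x ^ q) atTop := 
          lintegral_congr fun x => (hlim x).liminf_eq.symm
      _ ≤ liminf (fun N => ∫⁻ x, ψ N x ^ q) atTop := lintegral_liminf_le (fun N => (hψm N).pow_const q)
      _ ≤ C ^ q := by
          refine liminf_le_of_le (by isBoundedDefault) ?_
          intro b hb
          obtain ⟨N, hN⟩ := hb.exists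
          exact hN.trans (hbound N)
  exact ne_top_of_le_ne_top (ENNReal.rpow_ne_top_of_nonneg hq0.le hC) hfatou

lemma bl_pt (p r : ℝ) (hp : 0 < p) (hr : 0 < r) (ε : ℝ) (hε : 0 < ε) :
    ∃ C : ℝ, 0 ≤ C ∧ ∀ a b : ℝ, |(|a + b| ^ p - |a| ^ p - |b| ^ p)| ^ r ≤ ε * (|a| ^ p) ^ r + C * (|b| ^ p) ^ r := by
  have hcont : Tendsto (fun t : ℝ => |(|1 + t| ^ p - 1 - |t| ^ p)|) (nhds 0) (nhds 0) := by
    have : Continuous (fun t : ℝ => |(|1 + t| ^ p - 1 - |t| ^ p)|) := by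
      have h1 : Continuous (fun t : ℝ => |1 + t| ^ p) := Continuous.rpow_const (by fun_prop) (fun _ => Or.inr hp.le)
      have h2 : Continuous (fun t : ℝ => |t| ^ p) := Continuous.rpow_const (by fun_prop) (fun _ => Or.inr hp.le)
      fun_prop
    have h := this.tendsto 0
    simpa [Real.zero_rpow hp.ne'] using h
  have hε' : 0 < ε ^ (1/r) := by positivity
  obtain ⟨δ, hδ, hd⟩ := Metric.eventually_nhds_iff.mp (hcont.eventually_lt_const hε')
  set c : ℝ := (1/δ + 1) ^ p + (1/δ) ^ p + 1 with hc
  have hc0 : 0 ≤ c := by positivity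
  refine ⟨c ^ r, by positivity, fun a b => ?_⟩
  by_cases hab : |b| < δ * |a|
  · have ha : 0 < |a| := by
      by_contra h
      have : |a| = 0 := le_antisymm (not_lt.mp h) (abs_nonneg _)
      rw [this, mul_zero] at hab
      exact absurd hab (not_lt.mpr (abs_nonneg _))
    have ha' : a ≠ 0 := abs_pos.mp ha
    have h1 := hd (y := b / a) (by rw [Real.dist_eq, sub_zero, abs_div, div_lt_iff₀ ha]; exact hab)
    have e : |(|a + b| ^ p - |a| ^ p - |b| ^ p)| = |a| ^ p * |(|1 + b/a| ^ p - 1 - |b/a| ^ p)| := by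
      have : 0 < |a| ^ p := by positivity
      nth_rw 2 [← abs_of_pos this]
      rw [← abs_mul, mul_sub, mul_sub, ← Real.mul_rpow (abs_nonneg _) (abs_nonneg _), ← Real.mul_rpow (abs_nonneg _) (abs_nonneg _),
        ← abs_mul, ← abs_mul, mul_add, mul_div_cancel₀ _ ha', mul_one, mul_one]
    rw [e]
    calc _ ≤ (|a| ^ p * ε ^ (1/r)) ^ r := by gcongr
      _ = ε * (|a| ^ p) ^ r := by
          rw [Real.mul_rpow (by positivity) (by positivity), ← Real.rpow_mul hε.le, one_div_mul_cancel hr.ne', Real.rpow_one, mul_comm]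
      _ ≤ _ := le_add_of_nonneg_right (by positivity)
  · have h1 : |a| ≤ 1/δ * |b| := by
      rw [not_lt] at hab
      rw [one_div, ← div_eq_inv_mul, le_div_iff₀ hδ]; linarith
    have h2 : |a + b| ≤ (1/δ + 1) * |b| := by
      calc _ ≤ |a| + |b| := abs_add_le _ _
        _ ≤ _ := by linarith
    have h3 : |(|a + b| ^ p - |a| ^ p - |b| ^ p)| ≤ c * |b| ^ p := by
      have i1 : |a + b| ^ p ≤ (1/δ + 1) ^ p * |b| ^ p := by
        rw [← Real.mul_rpow (by positivity) (by positivity)]; gcongr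
      have i2 : |a| ^ p ≤ (1/δ) ^ p * |b| ^ p := by
        rw [← Real.mul_rpow (by positivity) (by positivity)]; gcongr
      have j1 : 0 ≤ |a + b| ^ p := by positivity
      have j2 : 0 ≤ |a| ^ p := by positivity
      have j3 : 0 ≤ |b| ^ p := by positivity
      rw [abs_le, hc]
      constructor <;> nlinarith
    calc _ ≤ (c * |b| ^ p) ^ r := by gcongr
      _ = c ^ r * (|b| ^ p) ^ r := Real.mul_rpow hc0 (by positivity)
      _ ≤ _ := le_add_of_nonneg_left (by positivity)

lemma bl_small (n : ℕ) (hn : 1 ≤ n) (μ : ℝ) (hμ0 : 0 < μ) (hμn : μ < n) (r : ℝ)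
    (hr : r = 2 * n / (2 * n - μ)) (e h : ℕ → EuclideanSpace ℝ (Fin n) → ℝ≥0∞)
    (he : ∀ k, Measurable (e k)) (hh : ∀ k, Measurable (h k))
    (h0 : Tendsto (fun k => ∫⁻ x, e k x ^ r) atTop (nhds 0)) (M : ℝ≥0∞) (hM : M ≠ ⊤)
    (hhM : ∀ k, ∫⁻ x, h k x ^ r ≤ M) :
    Tendsto (fun k => blD n μ (e k) (h k)) atTop (nhds 0) := by
  obtain ⟨C, hC, H⟩ := bl_hls n hn μ hμ0 hμn r hr
  have hn0 : (0:ℝ) < n := by exact_mod_cast hn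
  have hd : 0 < 2 * (n:ℝ) - μ := by linarith
  have hr0 : 0 < r := by rw [hr]; positivity
  rw [ENNReal.tendsto_nhds_zero]
  intro η hη
  rcases eq_or_ne η ⊤ with rfl | hηt
  · simp
  set B : ℝ≥0∞ := (M + 1) ^ (1/r) with hB
  have hBr : B ^ r = M + 1 := by rw [hB, ← ENNReal.rpow_mul, one_div_mul_cancel hr0.ne', ENNReal.rpow_one]
  have hBt : B ≠ ⊤ := ENNReal.rpow_ne_top_of_nonneg (by positivity) (by simp [hM])
  have hB0 : B ≠ 0 := by
    intro h
    rw [h, ENNReal.zero_rpow_of_pos hr0] at hBr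
    exact (by simp : M + 1 ≠ 0) hBr.symm
  have hCB : C * B + 1 ≠ ⊤ := by simp [ENNReal.mul_eq_top, hC, hBt]
  set δ := η / (C * B + 1) with hδ
  have hδ0 : δ ≠ 0 := ENNReal.div_ne_zero.mpr ⟨hη.ne', hCB⟩
  have hδt : δ ≠ ⊤ := (ENNReal.div_lt_top hηt (by simp)).ne
  rw [ENNReal.tendsto_nhds_zero] at h0
  filter_upwards [h0 (δ ^ r) (ENNReal.rpow_pos (pos_iff_ne_zero.mpr hδ0) hδt)] with k hk
  calc _ ≤ C * δ * B := H _ _ (he k) (hh k) δ B hδ0 hδt hB0 hBt hk ((hhM k).trans (by rw [hBr]; exact le_self_add))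
    _ = δ * (C * B) := by ring
    _ ≤ δ * (C * B + 1) := by gcongr; exact le_self_add
    _ = η := ENNReal.div_mul_cancel (by simp) hCB

lemma bl_fin (n : ℕ) (hn : 1 ≤ n) (μ : ℝ) (hμ0 : 0 < μ) (hμn : μ < n) (r : ℝ)
    (hr : r = 2 * n / (2 * n - μ)) (M : ℝ≥0∞) (hM : M ≠ ⊤) :
    ∃ C : ℝ≥0∞, C ≠ ⊤ ∧ ∀ f h : EuclideanSpace ℝ (Fin n) → ℝ≥0∞, Measurable f → Measurable h →
     ∫⁻ x, f x ^ r ≤ M →  ∫⁻ x, h x ^ r ≤ M → blD n μ f h ≤ C := by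
  obtain ⟨C, hC, H⟩ := bl_hls n hn μ hμ0 hμn r hr
  have hn0 : (0:ℝ) < n := by exact_mod_cast hn
  have hd : 0 < 2 * (n:ℝ) - μ := by linarith
  have hr0 : 0 < r := by rw [hr]; positivity
  set B : ℝ≥0∞ := (M + 1) ^ (1/r) with hB
  have hBr : B ^ r = M + 1 := by rw [hB, ← ENNReal.rpow_mul, one_div_mul_cancel hr0.ne', ENNReal.rpow_one]
  have hBt : B ≠ ⊤ := ENNReal.rpow_ne_top_of_nonneg (by positivity) (by simp [hM])
  have hB0 : B ≠ 0 := by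
    intro h
    rw [h, ENNReal.zero_rpow_of_pos hr0] at hBr
    exact (by simp : M + 1 ≠ 0) hBr.symm
  refine ⟨C * B * B, ENNReal.mul_ne_top (ENNReal.mul_ne_top hC hBt) hBt, fun f h hf hh h1 h2 => ?_⟩
  exact H f h hf hh B B hB0 hBt hB0 hBt (h1.trans (by rw [hBr]; exact le_self_add)) (h2.trans (by rw [hBr]; exact le_self_add))

lemma bl_weak (n : ℕ) (hn : 1 ≤ n) (μ : ℝ) (hμ0 : 0 < μ) (hμn : μ < n) (r : ℝ)
    (hr : r = 2 * n / (2 * n - μ)) (f : EuclideanSpace ℝ (Fin n) → ℝ≥0∞) (g : ℕ → EuclideanSpace ℝ (Fin n) → ℝ≥0∞)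
    (hf : Measurable f) (hg : ∀ k, Measurable (g k)) (M : ℝ≥0∞) (hM : M ≠ ⊤)
    (hfM : ∫⁻ x, f x ^ r ≤ M) (hgM : ∀ k, ∫⁻ x, g k x ^ r ≤ M)
    (h0 : ∀ᵐ x, Tendsto (fun k => g k x) atTop (nhds 0)) :
    Tendsto (fun k => blD n μ f (g k)) atTop (nhds 0) := by
  have hK := blK_meas n μ
  have hn0 : (0:ℝ) < n := by exact_mod_cast hn
  have hd : 0 < 2 * (n:ℝ) - μ := by linarith
  have hr0 : 0 < r := by rw [hr]; positivity
  set q : ℝ := 2 * n / μ with hq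
  have hq0 : 0 < q := by positivity
  have hconj : r.HolderConjugate q := by
    rw [Real.holderConjugate_iff]
    constructor
    · rw [hr, lt_div_iff₀ hd]; linarith
    · rw [hr, hq]; field_simp; ring
  set φ : EuclideanSpace ℝ (Fin n) → ℝ≥0∞ := fun x => ∫⁻ y, f y * blK n μ (x - y) with hφ
  have hφm : Measurable φ := 
    Measurable.lintegral_prod_right' (f := fun z : EuclideanSpace ℝ (Fin n) × EuclideanSpace ℝ (Fin n) => f z.2 * blK n μ (z.1 - z.2)) (by fun_prop)
  have hD : ∀ G : EuclideanSpace ℝ (Fin n) → ℝ≥0∞, Measurable G → blD n μ f G = ∫⁻ x, G x * φ x := by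
    intro G hG
    rw [blD_symm n μ f G hf hG]
    unfold blD
    refine lintegral_congr fun x => ?_
    rw [hφ, ← lintegral_const_mul _ (by fun_prop)]
    refine lintegral_congr fun y => ?_
    ring
  obtain ⟨C, hC, H⟩ := bl_fin n hn μ hμ0 hμn r hr (M + 1) (by simp [hM])
  have hφq : ∫⁻ x, φ x ^ q ≠ ⊤ := by
    refine bl_dual n r q hconj φ hφm C hC fun G hG hG1 => ?_
    rw [← hD G hG]
    exact H f G hf hG (hfM.trans le_self_add) (hG1.trans le_add_self)
  have heq : ∀ k, blD n μ f (g k) = ∫⁻ x, if φ x = ⊤ then 0 else g k x * φ x := by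
    intro k
    rw [hD _ (hg k)]
    refine lintegral_congr_ae ?_
    filter_upwards [ae_lt_top (hφm.pow_const q) hφq] with x hx
    rw [if_neg]
    intro h
    rw [h, ENNReal.top_rpow_of_pos hq0] at hx
    exact lt_irrefl _ hx
  simp_rw [heq]
  refine bl_dct volume (fun k x => if φ x = ⊤ then 0 else g k x * φ x) (fun k x => g k x ^ r) ?_ (fun k => (hg k).pow_const r) ?_ M hM hgM ?_
  · intro k
    exact Measurable.ite (hφm (measurableSet_singleton ⊤)) measurable_const ((hg k).mul hφm)
  · filter_upwards [h0] with x hx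
    by_cases hx' : φ x = ⊤
    · simp [hx']
    · simp only [hx', if_false]
      have := ENNReal.Tendsto.mul_const hx (b := φ x) (Or.inr hx')
      simpa using this
  · intro ε hε hεt
    set δ := ε ^ (1/r) with hδ
    have hδr : δ ^ r = ε := by rw [hδ, ← ENNReal.rpow_mul, one_div_mul_cancel hr0.ne', ENNReal.rpow_one]
    have hδt : δ ≠ ⊤ := ENNReal.rpow_ne_top_of_nonneg (by positivity) hεt
    have hδ0 : δ ≠ 0 := by
      intro h
      rw [h, ENNReal.zero_rpow_of_pos hr0] at hδr
      exact hε hδr.symm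
    refine ⟨fun x => (δ⁻¹) ^ q * φ x ^ q, ?_, ?_⟩
    · rw [lintegral_const_mul _ (by fun_prop)]
      exact ENNReal.mul_ne_top (ENNReal.rpow_ne_top_of_nonneg hq0.le (ENNReal.inv_ne_top.mpr hδ0)) hφq
    · intro k x
      calc (if φ x = ⊤ then 0 else g k x * φ x) ≤ g k x * φ x := by split_ifs <;> simp
        _ = (δ * δ⁻¹) * (g k x * φ x) := by rw [ENNReal.mul_inv_cancel hδ0 hδt, one_mul]
        _ = (δ * g k x) * (δ⁻¹ * φ x) := by ring
        _ ≤ (δ * g k x) ^ r / ENNReal.ofReal r + (δ⁻¹ * φ x) ^ q / ENNReal.ofReal q := ENNReal.young_inequality _ _ hconj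
        _ ≤ (δ * g k x) ^ r + (δ⁻¹ * φ x) ^ q := by
            have one : ∀ (a : ℝ≥0∞) (s : ℝ), 1 < s → a / ENNReal.ofReal s ≤ a := by
              intro a s hs
              apply ENNReal.div_le_of_le_mul
              calc a = a * 1 := (mul_one a).symm
                _ ≤ _ := by gcongr; exact ENNReal.one_le_ofReal.mpr hs.le
            exact add_le_add (one _ _ hconj.lt) (one _ _ hconj.symm.lt)
        _ = _ := by rw [ENNReal.mul_rpow_of_nonneg _ _ hr0.le, ENNReal.mul_rpow_of_nonneg _ _ hq0.le, hδr]

lemma blD_sq (n : ℕ) (μ : ℝ) (F G : EuclideanSpace ℝ (Fin n) → ℝ≥0∞) (hF : Measurable F) (hG : Measurable G) :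
    blD n μ (fun x => F x + G x) (fun x => F x + G x) = blD n μ F F + 2 * blD n μ F G + blD n μ G G := by
  have hFG : Measurable (fun x => F x + G x) := by fun_prop
  rw [blD_add_left n μ F G _ hF hFG, blD_symm n μ F _ hF hFG, blD_symm n μ G _ hG hFG,
    blD_add_left n μ F G F hF hF, blD_add_left n μ F G G hF hG, blD_symm n μ G F hG hF]
  ring

lemma bl_energy_congr (n : ℕ) (μ : ℝ) (u v : EuclideanSpace ℝ (Fin n) → ℝ) (h : u =ᵐ[volume] v) :
    hlsEnergy n μ u = hlsEnergy n μ v := by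
  unfold hlsEnergy
  refine lintegral_congr_ae ?_
  filter_upwards [h] with x hx
  refine lintegral_congr_ae ?_
  filter_upwards [h] with y hy
  rw [hx, hy]

lemma bl_energy_eq (n : ℕ) (μ : ℝ) (v : EuclideanSpace ℝ (Fin n) → ℝ) (p : ℝ) (hp : p = (2 * (n : ℝ) - μ) / ((n : ℝ) - 2)) :
    hlsEnergy n μ v = blD n μ (fun x => ENNReal.ofReal (|v x| ^ p)) (fun x => ENNReal.ofReal (|v x| ^ p)) := by
  unfold hlsEnergy blD blK
  refine lintegral_congr fun x => lintegral_congr fun y => ?_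
  rw [← hp, ← ENNReal.ofReal_mul (by positivity), ← ENNReal.ofReal_mul (by positivity), Real.rpow_neg (norm_nonneg _), div_eq_mul_inv]

lemma bl_main (n : ℕ) (hn : 3 ≤ n) (μ : ℝ) (hμ0 : 0 < μ) (hμn : μ < n)
    (u : EuclideanSpace ℝ (Fin n) → ℝ) (uk : ℕ → EuclideanSpace ℝ (Fin n) → ℝ)
    (hu : Measurable u) (hmeas : ∀ k, Measurable (uk k))
    (hbdd : ∃ C : ℝ≥0∞, C < ⊤ ∧ ∀ k,
      eLpNorm (uk k) (ENNReal.ofReal (2 * n / ((n : ℝ) - 2))) volume ≤ C)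
    (hae : ∀ᵐ x : EuclideanSpace ℝ (Fin n), Tendsto (fun k => uk k x) atTop (nhds (u x))) :
    Tendsto (fun k => (hlsEnergy n μ (uk k)).toReal -
        (hlsEnergy n μ (fun x => uk k x - u x)).toReal) atTop
      (nhds (hlsEnergy n μ u).toReal) := by
  have hn3 : (3:ℝ) ≤ n := by exact_mod_cast hn
  have hn1 : 1 ≤ n := by omega
  have hn2 : 0 < (n:ℝ) - 2 := by linarith
  have hd : 0 < 2 * (n:ℝ) - μ := by linarith
  obtain ⟨p, hp⟩ : ∃ p, p = (2 * (n : ℝ) - μ) / ((n : ℝ) - 2) := ⟨_, rfl⟩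
  obtain ⟨r, hr⟩ : ∃ r, r = 2 * (n:ℝ) / (2 * n - μ) := ⟨_, rfl⟩
  obtain ⟨Q, hQ⟩ : ∃ Q, Q = 2 * (n:ℝ) / ((n:ℝ) - 2) := ⟨_, rfl⟩
  have hp0 : 0 < p := by rw [hp]; positivity
  have hr0 : 0 < r := by rw [hr]; positivity
  have hQ0 : 0 < Q := by rw [hQ]; positivity
  have hpr : p * r = Q := by rw [hp, hr, hQ]; field_simp
  obtain ⟨C, hC, hCb⟩ := hbdd
  rw [← hQ] at hCb
  simp_rw [bl_energy_eq n μ _ p hp]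
  have hpow : ∀ s : ℝ, ENNReal.ofReal (|s| ^ p) ^ r = ENNReal.ofReal (|s| ^ Q) := by
    intro s
    rw [ENNReal.ofReal_rpow_of_nonneg (by positivity) hr0.le, ← Real.rpow_mul (abs_nonneg _), hpr]
  set f : ℕ → EuclideanSpace ℝ (Fin n) → ℝ≥0∞ := fun k x => ENNReal.ofReal (|uk k x| ^ p) with hf
  set g : ℕ → EuclideanSpace ℝ (Fin n) → ℝ≥0∞ := fun k x => ENNReal.ofReal (|uk k x - u x| ^ p) with hg
  set w : EuclideanSpace ℝ (Fin n) → ℝ≥0∞ := fun x => ENNReal.ofReal (|u x| ^ p) with hw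
  set e : ℕ → EuclideanSpace ℝ (Fin n) → ℝ≥0∞ := fun k x => 
    ENNReal.ofReal |(|uk k x| ^ p - |uk k x - u x| ^ p - |u x| ^ p)| with he
  have hfm : ∀ k, Measurable (f k) := fun k => by have := hmeas k; simp only [hf, ← Real.norm_eq_abs]; fun_prop
  have hgm : ∀ k, Measurable (g k) := fun k => by have := hmeas k; simp only [hg, ← Real.norm_eq_abs]; fun_prop
  have hwm : Measurable w := by simp only [hw, ← Real.norm_eq_abs]; fun_prop
  have hem : ∀ k, Measurable (e k) := fun k => by have := hmeas k; simp only [he, ← Real.norm_eq_abs]; fun_prop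
  -- bounds
  have hfM : ∀ k, ∫⁻ x, f k x ^ r ≤ C ^ Q := by
    intro k
    have h := hCb k
    rw [eLpNorm_eq_lintegral_rpow_enorm_toReal (by simpa using hQ0) (by simp), ENNReal.toReal_ofReal hQ0.le] at h
    have h2 : ∫⁻ x, f k x ^ r = ∫⁻ x, ‖uk k x‖ₑ ^ Q := by
      refine lintegral_congr fun x => ?_
      simp only [hf]
      rw [hpow, Real.enorm_eq_ofReal_abs, ENNReal.ofReal_rpow_of_nonneg (abs_nonneg _) hQ0.le]
    rw [h2]
    calc _ = ((∫⁻ x, ‖uk k x‖ₑ ^ Q) ^ (1/Q)) ^ Q := by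
          rw [← ENNReal.rpow_mul, one_div_mul_cancel hQ0.ne', ENNReal.rpow_one]
      _ ≤ _ := by gcongr
  have hlim : ∀ᵐ x, Tendsto (fun k => f k x ^ r) atTop (nhds (w x ^ r)) := by
    filter_upwards [hae] with x hx
    refine (ENNReal.continuous_rpow_const.tendsto _).comp ?_
    refine ENNReal.tendsto_ofReal ?_
    exact hx.abs.rpow_const (Or.inr hp0.le)
  have hwM : ∫⁻ x, w x ^ r ≤ C ^ Q := by
    calc ∫⁻ x, w x ^ r = ∫⁻ x, liminf (fun k => f k x ^ r) atTop := by
          refine lintegral_congr_ae ?_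
          filter_upwards [hlim] with x hx
          exact hx.liminf_eq.symm
      _ ≤ liminf (fun k => ∫⁻ x, f k x ^ r) atTop := lintegral_liminf_le (fun N => (hfm N).pow_const r)
      _ ≤ C ^ Q := by
          refine liminf_le_of_le (by isBoundedDefault) ?_
          intro b hb
          obtain ⟨N, hN⟩ := hb.exists
          exact hN.trans (hfM N)
  have hCQ : C ^ Q ≠ ⊤ := ENNReal.rpow_ne_top_of_nonneg hQ0.le hC.ne
  obtain ⟨M, hM⟩ : ∃ M, M = ENNReal.ofReal (2 ^ Q) * (C ^ Q + C ^ Q) := ⟨_, rfl⟩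
  have hMt : M ≠ ⊤ := by
    rw [hM]; exact ENNReal.mul_ne_top ENNReal.ofReal_ne_top (by simp [hCQ])
  have hgM : ∀ k, ∫⁻ x, g k x ^ r ≤ M := by
    intro k
    have hpt : ∀ x, g k x ^ r ≤ ENNReal.ofReal (2 ^ Q) * (f k x ^ r + w x ^ r) := by
      intro x
      simp only [hg, hf, hw, hpow]
      rw [← ENNReal.ofReal_add (by positivity) (by positivity), ← ENNReal.ofReal_mul (by positivity)]
      apply ENNReal.ofReal_le_ofReal
      have h1 : |uk k x - u x| ≤ 2 * max |uk k x| |u x| := by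
        have := abs_sub (uk k x) (u x)
        have := le_max_left |uk k x| |u x|
        have := le_max_right |uk k x| |u x|
        linarith
      calc |uk k x - u x| ^ Q ≤ (2 * max |uk k x| |u x|) ^ Q := by gcongr
        _ = 2 ^ Q * (max |uk k x| |u x|) ^ Q := Real.mul_rpow (by norm_num) (by positivity)
        _ ≤ _ := by
            gcongr
            rcases le_total |uk k x| |u x| with h | h
            · rw [max_eq_right h]; exact le_add_of_nonneg_left (by positivity)
            · rw [max_eq_left h]; exact le_add_of_nonneg_right (by positivity)
    calc _ ≤ ∫⁻ x, ENNReal.ofReal (2 ^ Q) * (f k x ^ r + w x ^ r) := lintegral_mono hpt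
      _ = ENNReal.ofReal (2 ^ Q) * ((∫⁻ x, f k x ^ r) + ∫⁻ x, w x ^ r) := by
          have := hfm k
          rw [lintegral_const_mul _ (by fun_prop), lintegral_add_left (by fun_prop)]
      _ ≤ M := by rw [hM]; gcongr; exact hfM k
  have hCM : C ^ Q ≤ M := by
    rw [hM]
    calc C ^ Q = 1 * C ^ Q := (one_mul _).symm
      _ ≤ _ := by
        refine mul_le_mul' ?_ le_self_add
        exact ENNReal.one_le_ofReal.mpr (Real.one_le_rpow (by norm_num) hQ0.le)
  have hfM' : ∀ k, ∫⁻ x, f k x ^ r ≤ M := fun k => (hfM k).trans hCM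
  have hwM' : ∫⁻ x, w x ^ r ≤ M := hwM.trans hCM
  -- convergence of g and e
  have hg0 : ∀ᵐ x, Tendsto (fun k => g k x) atTop (nhds 0) := by
    filter_upwards [hae] with x hx
    have h1 : Tendsto (fun k => |uk k x - u x| ^ p) atTop (nhds (|u x - u x| ^ p)) :=
      (hx.sub_const (u x)).abs.rpow_const (Or.inr hp0.le)
    have h2 := ENNReal.tendsto_ofReal h1
    simpa [Real.zero_rpow hp0.ne'] using h2
  have he0 : Tendsto (fun k => ∫⁻ x, e k x ^ r) atTop (nhds 0) := by
    refine bl_dct volume (fun k x => e k x ^ r) (fun k x => g k x ^ r) (fun k => (hem k).pow_const r) 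
      (fun k => (hgm k).pow_const r) ?_ M hMt hgM ?_
    · filter_upwards [hae] with x hx
      have h1 : Tendsto (fun k => |(|uk k x| ^ p - |uk k x - u x| ^ p - |u x| ^ p)|) atTop 
          (nhds |(|u x| ^ p - |u x - u x| ^ p - |u x| ^ p)|) :=
        (((hx.abs.rpow_const (Or.inr hp0.le)).sub ((hx.sub_const (u x)).abs.rpow_const (Or.inr hp0.le))).sub_const _).abs
      have h2 := ((ENNReal.continuous_rpow_const (y := r)).tendsto _).comp (ENNReal.tendsto_ofReal h1)
      simpa [Real.zero_rpow hp0.ne', ENNReal.zero_rpow_of_pos hr0, Function.comp_def, he] using h2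
    · intro ε hε hεt
      obtain ⟨c, hc, hcb⟩ := bl_pt p r hp0 hr0 ε.toReal (ENNReal.toReal_pos hε hεt)
      refine ⟨fun x => ENNReal.ofReal c * w x ^ r, ?_, ?_⟩
      · rw [lintegral_const_mul _ (by fun_prop)]
        exact ENNReal.mul_ne_top ENNReal.ofReal_ne_top (ne_top_of_le_ne_top hMt hwM')
      · intro k x
        have h := hcb (uk k x - u x) (u x)
        rw [sub_add_cancel] at h
        simp only [he, hg, hw]
        rw [ENNReal.ofReal_rpow_of_nonneg (by positivity) hr0.le, ENNReal.ofReal_rpow_of_nonneg (by positivity) hr0.le,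
          ENNReal.ofReal_rpow_of_nonneg (by positivity) hr0.le]
        nth_rw 1 [← ENNReal.ofReal_toReal hεt]
        rw [← ENNReal.ofReal_mul (by positivity), ← ENNReal.ofReal_mul (by positivity), ← ENNReal.ofReal_add (by positivity) (by positivity)]
        exact ENNReal.ofReal_le_ofReal h
  -- error terms
  have t1 := bl_weak n hn1 μ hμ0 hμn r hr w g hwm hgm M hMt hwM' hgM hg0
  have t2 := bl_small n hn1 μ hμ0 hμn r hr e g hem hgm he0 M hMt hgM
  have t3 := bl_small n hn1 μ hμ0 hμn r hr e (fun _ => w) hem (fun _ => hwm) he0 M hMt (fun _ => hwM')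
  have t4 := bl_small n hn1 μ hμ0 hμn r hr e f hem hfm he0 M hMt hfM'
  obtain ⟨c, hct, hfin⟩ := bl_fin n hn1 μ hμ0 hμn r hr M hMt
  have hT : ∀ k, blD n μ (f k) (f k) ≠ ⊤ := fun k => ne_top_of_le_ne_top hct (hfin _ _ (hfm k) (hfm k) (hfM' k) (hfM' k))
  have hS : ∀ k, blD n μ (g k) (g k) ≠ ⊤ := fun k => ne_top_of_le_ne_top hct (hfin _ _ (hgm k) (hgm k) (hgM k) (hgM k))
  have hP : blD n μ w w ≠ ⊤ := ne_top_of_le_ne_top hct (hfin _ _ hwm hwm hwM' hwM')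
  set err : ℕ → ℝ≥0∞ := fun k => 2 * blD n μ w (g k) + 3 * blD n μ (e k) (g k) + 3 * blD n μ (e k) w + 3 * blD n μ (e k) (f k) with herr
  have herr0 : Tendsto err atTop (nhds 0) := by
    have h := (((ENNReal.Tendsto.const_mul (a := 2) t1 (Or.inr (by norm_num))).add 
      (ENNReal.Tendsto.const_mul (a := 3) t2 (Or.inr (by norm_num)))).add 
      (ENNReal.Tendsto.const_mul (a := 3) t3 (Or.inr (by norm_num)))).add 
      (ENNReal.Tendsto.const_mul (a := 3) t4 (Or.inr (by norm_num)))
    simpa using h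
  have hpt1 : ∀ k x, f k x ≤ (w x + g k x) + e k x := by
    intro k x
    simp only [hf, hw, hg, he]
    rw [← ENNReal.ofReal_add (by positivity) (by positivity), ← ENNReal.ofReal_add (by positivity) (by positivity)]
    apply ENNReal.ofReal_le_ofReal
    have := le_abs_self (|uk k x| ^ p - |uk k x - u x| ^ p - |u x| ^ p)
    linarith
  have hpt2 : ∀ k x, w x + g k x ≤ f k x + e k x := by
    intro k x
    simp only [hf, hw, hg, he]
    rw [← ENNReal.ofReal_add (by positivity) (by positivity), ← ENNReal.ofReal_add (by positivity) (by positivity)]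
    apply ENNReal.ofReal_le_ofReal
    have := neg_abs_le (|uk k x| ^ p - |uk k x - u x| ^ p - |u x| ^ p)
    linarith
  have hpt3 : ∀ k x, e k x ≤ (w x + g k x) + f k x := by
    intro k x
    simp only [hf, hw, hg, he]
    rw [← ENNReal.ofReal_add (by positivity) (by positivity), ← ENNReal.ofReal_add (by positivity) (by positivity)]
    apply ENNReal.ofReal_le_ofReal
    have h1 : 0 ≤ |uk k x| ^ p := by positivity
    have h2 : 0 ≤ |uk k x - u x| ^ p := by positivity
    have h3 : 0 ≤ |u x| ^ p := by positivity
    rw [abs_le]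
    constructor <;> linarith
  have hadd : ∀ k, blD n μ (e k) (fun x => w x + g k x) = blD n μ (e k) w + blD n μ (e k) (g k) := by
    intro k
    have h1 : Measurable (fun x => w x + g k x) := hwm.add (hgm k)
    rw [blD_symm n μ _ _ (hem k) h1, blD_add_left n μ _ _ _ hwm (hem k), blD_symm n μ _ _ hwm (hem k), blD_symm n μ _ _ (hgm k) (hem k)]
  have hee : ∀ k, blD n μ (e k) (e k) ≤ blD n μ (e k) w + blD n μ (e k) (g k) + blD n μ (e k) (f k) := by
    intro k
    have h1 : Measurable (fun x => w x + g k x) := hwm.add (hgm k)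
    have h2 : Measurable (fun x => (w x + g k x) + f k x) := h1.add (hfm k)
    refine (blD_mono n μ (e k) (e k) (e k) _ (fun _ => le_rfl) (hpt3 k)).trans (le_of_eq ?_)
    rw [blD_symm n μ _ _ (hem k) h2, blD_add_left n μ _ _ _ h1 (hem k), blD_symm n μ _ _ h1 (hem k), hadd, blD_symm n μ _ _ (hfm k) (hem k)]
  have up : ∀ k, blD n μ (f k) (f k) ≤ blD n μ (g k) (g k) + blD n μ w w + err k := by
    intro k
    have h1 : Measurable (fun x => w x + g k x) := hwm.add (hgm k)
    refine (blD_mono n μ _ _ _ _ (hpt1 k) (hpt1 k)).trans ?_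
    rw [blD_sq n μ _ _ h1 (hem k), blD_sq n μ _ _ hwm (hgm k), blD_symm n μ _ _ h1 (hem k), hadd]
    calc _ ≤ blD n μ w w + 2 * blD n μ w (g k) + blD n μ (g k) (g k) + 2 * (blD n μ (e k) w + blD n μ (e k) (g k)) +
            (blD n μ (e k) w + blD n μ (e k) (g k) + blD n μ (e k) (f k)) := by gcongr; exact hee k
      _ ≤ blD n μ w w + 2 * blD n μ w (g k) + blD n μ (g k) (g k) + 2 * (blD n μ (e k) w + blD n μ (e k) (g k)) +
            (blD n μ (e k) w + blD n μ (e k) (g k) + blD n μ (e k) (f k)) + 2 * blD n μ (e k) (f k) := le_self_add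
      _ = _ := by simp only [herr]; ring
  have lo : ∀ k, blD n μ (g k) (g k) + blD n μ w w ≤ blD n μ (f k) (f k) + err k := by
    intro k
    have h1 : Measurable (fun x => w x + g k x) := hwm.add (hgm k)
    calc blD n μ (g k) (g k) + blD n μ w w ≤ blD n μ (g k) (g k) + blD n μ w w + 2 * blD n μ w (g k) := le_self_add
      _ = blD n μ (fun x => w x + g k x) (fun x => w x + g k x) := by rw [blD_sq n μ _ _ hwm (hgm k)]; ring
      _ ≤ blD n μ (fun x => f k x + e k x) (fun x => f k x + e k x) := blD_mono n μ _ _ _ _ (hpt2 k) (hpt2 k)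
      _ = blD n μ (f k) (f k) + 2 * blD n μ (e k) (f k) + blD n μ (e k) (e k) := by
          rw [blD_sq n μ _ _ (hfm k) (hem k), blD_symm n μ (f k) _ (hfm k) (hem k)]
      _ ≤ blD n μ (f k) (f k) + 2 * blD n μ (e k) (f k) + (blD n μ (e k) w + blD n μ (e k) (g k) + blD n μ (e k) (f k)) := by
          gcongr; exact hee k
      _ ≤ blD n μ (f k) (f k) + 2 * blD n μ (e k) (f k) + (blD n μ (e k) w + blD n μ (e k) (g k) + blD n μ (e k) (f k)) 
            + (2 * blD n μ w (g k) + 2 * blD n μ (e k) (g k) + 2 * blD n μ (e k) w) := le_self_add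
      _ = _ := by simp only [herr]; ring
  rw [tendsto_iff_dist_tendsto_zero]
  have herrR : Tendsto (fun k => (err k).toReal) atTop (nhds 0) := by
    have := (ENNReal.tendsto_toReal ENNReal.zero_ne_top).comp herr0
    simpa [Function.comp_def] using this
  refine squeeze_zero' (Eventually.of_forall fun _ => dist_nonneg) ?_ herrR
  filter_upwards [herr0.eventually_lt_const ENNReal.zero_lt_top] with k hk
  have a1 := ENNReal.toReal_mono (by simp [hS k, hP, hk.ne]) (up k)
  have a2 := ENNReal.toReal_mono (by simp [hT k, hk.ne]) (lo k)
  rw [ENNReal.toReal_add (by simp [hS k, hP]) hk.ne, ENNReal.toReal_add (hS k) hP] at a1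
  rw [ENNReal.toReal_add (hT k) hk.ne, ENNReal.toReal_add (hS k) hP] at a2
  rw [Real.dist_eq, abs_le]
  constructor <;> linarith

theorem brezis_lieb_hls (n : ℕ) (hn : 3 ≤ n) (μ : ℝ) (hμ0 : 0 < μ) (hμn : μ < n)
    (u : EuclideanSpace ℝ (Fin n) → ℝ) (uk : ℕ → EuclideanSpace ℝ (Fin n) → ℝ)
    (hmeas : ∀ k, Measurable (uk k))
    (hbdd : ∃ C : ℝ≥0∞, C < ⊤ ∧ ∀ k,
      eLpNorm (uk k) (ENNReal.ofReal (2 * n / ((n : ℝ) - 2))) volume ≤ C)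
    (hae : ∀ᵐ x : EuclideanSpace ℝ (Fin n), Tendsto (fun k => uk k x) atTop (nhds (u x))) :
    Tendsto (fun k => (hlsEnergy n μ (uk k)).toReal -
        (hlsEnergy n μ (fun x => uk k x - u x)).toReal) atTop
      (nhds (hlsEnergy n μ u).toReal) := by
  have hum : AEMeasurable u := aemeasurable_of_tendsto_metrizable_ae' (fun k => (hmeas k).aemeasurable) hae
  obtain ⟨v, hv, huv⟩ := hum
  have e1 : hlsEnergy n μ u = hlsEnergy n μ v := bl_energy_congr n μ u v huv
  have e2 : ∀ k, hlsEnergy n μ (fun x => uk k x - u x) = hlsEnergy n μ (fun x => uk k x - v x) := by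
    intro k
    apply bl_energy_congr
    filter_upwards [huv] with x hx
    rw [hx]
  simp_rw [e1, e2]
  refine bl_main n hn μ hμ0 hμn v uk hv hmeas hbdd ?_
  filter_upwards [hae, huv] with x hx hx'
  rwa [← hx']
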